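/- Let G = ⟨x, H; R⟩ be given by an M_H-presentation, and suppose G is residually finite. Then for every integer n > 1 the group G_n = ⟨x, H; R^n⟩, defined by the relative one-relator presentation with relator the n-th power of R, is also residually finite. -/

import Mathlib

open Monoid

section Defs
variable {X Y H : Type*}

/-- `φ_W^θ(j)`: the sum `Σ_{i=1}^{j} ε_i θ(x_i)` of the weights of the first `j`
letters of the word `W` (a word is a nonempty list of pairs (letter, exponent sign)). -/
def phiW (θ : X → ℤ) (W : List (X × Bool)) (j : ℕ) : ℤ :=
  ((W.take j).map fun p => if p.2 then θ p.1 else -θ p.1).sum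

/-- A weight function: a map `θ : X → ℤ` whose image generates the additive group `ℤ`. -/
def IsWeightFun (θ : X → ℤ) : Prop :=
  AddSubgroup.closure (Set.range θ) = ⊤

/-- A strict weight function: `θ x ≠ 0` for all `x`. -/
def IsStrictWeight (θ : X → ℤ) : Prop := ∀ x, θ x ≠ 0

/-- `θ` is admissible for `W` if `φ(r) = 0` where `r` is the length of `W`. -/
def IsAdmissible (θ : X → ℤ) (W : List (X × Bool)) : Prop :=
  phiW θ W W.length = 0

/-- The successor of an index, cyclically (subscripts mod `r`). -/
def succIdx (W : List (X × Bool)) (k : Fin W.length) : Fin W.length :=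
  ⟨(k.1 + 1) % W.length, Nat.mod_lt _ k.pos⟩

/-- `W` has the unique max-min property with respect to the weight function `θ`:
`θ` is a strict weight function, admissible for `W`, the graph of `W` has a unique
maximum at `k` and a unique minimum at `l`, and `W` is reduced at the maximum and
minimum (`x_k ≠ x_{k+1}`, `x_l ≠ x_{l+1}`, subscripts mod `r`). -/
def UniqueMaxMinWith (θ : X → ℤ) (W : List (X × Bool)) : Prop :=
  W ≠ [] ∧ IsWeightFun θ ∧ IsStrictWeight θ ∧ IsAdmissible θ W ∧
  ∃ k l : Fin W.length,
    (∀ j : Fin W.length, j ≠ k → phiW θ W (j.1 + 1) < phiW θ W (k.1 + 1)) ∧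
    (∀ j : Fin W.length, j ≠ l → phiW θ W (l.1 + 1) < phiW θ W (j.1 + 1)) ∧
    (W.get k).1 ≠ (W.get (succIdx W k)).1 ∧
    (W.get l).1 ≠ (W.get (succIdx W l)).1

/-- `W` has the unique max-min property: it has it with respect to some
admissible strict weight function. -/
def HasUniqueMaxMin (W : List (X × Bool)) : Prop :=
  ∃ θ : X → ℤ, UniqueMaxMinWith θ W

/-- The `x`-skeleton of a relator `R = x₁^{ε₁} h₁ ⋯ x_r^{ε_r} h_r`
(encoded as the list of triples `(xᵢ, εᵢ, hᵢ)`): the word `x₁^{ε₁} ⋯ x_r^{ε_r}`. -/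
def skel (R : List (X × Bool × H)) : List (X × Bool) :=
  R.map fun t => (t.1, t.2.1)

variable [Group H]

/-- The element of the free product `H ∗ F(X)` represented by the relator
`R = x₁^{ε₁} h₁ ⋯ x_r^{ε_r} h_r`. -/
def relWord (R : List (X × Bool × H)) : Coprod H (FreeGroup X) :=
  (R.map fun t => Coprod.inr (FreeGroup.mk [(t.1, t.2.1)]) * Coprod.inl t.2.2).prod

/-- The group `G(P)` defined by the relative one-relator presentation
`P = ⟨x, H; R⟩`: the quotient of `H ∗ F(X)` by the normal closure of `R`. -/
def relGroup (R : List (X × Bool × H)) : Type _ :=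
  Coprod H (FreeGroup X) ⧸ Subgroup.normalClosure {relWord R}

instance (R : List (X × Bool × H)) : Group (relGroup R) :=
  QuotientGroup.Quotient.group _

/-- The natural homomorphism `ν : H → G(P)`. -/
def natHom (R : List (X × Bool × H)) : H →* relGroup R :=
  (QuotientGroup.mk' _).comp Coprod.inl

end Defs

/-- A group is residually finite if every nontrivial element is sent to a
nontrivial element by some homomorphism to a finite group. -/
def ResiduallyFinite (G : Type*) [Group G] : Prop :=
  ∀ g : G, g ≠ 1 → ∃ (Q : Type) (_ : Group Q) (_ : Finite Q) (f : G →* Q), f g ≠ 1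

/-- The group defined by the relative one-relator presentation `⟨x, H; Rⁿ⟩`,
whose single relator is the `n`-th power of `R`. -/
def relGroupPow {X H : Type*} [Group H] (R : List (X × Bool × H)) (n : ℕ) : Type _ :=
  Coprod H (FreeGroup X) ⧸ Subgroup.normalClosure {relWord R ^ n}

instance {X H : Type*} [Group H] (R : List (X × Bool × H)) (n : ℕ) :
    Group (relGroupPow R n) := QuotientGroup.Quotient.group _

namespace ResiduallyFinite

/-- The finite quotients in `ResiduallyFinite` may be taken in any universe. -/
theorem of_forall_exists_hom {G : Type*} [Group G]
    (h : ∀ g : G, g ≠ 1 → ∃ (Q : Type*) (_ : Group Q) (_ : Finite Q) (f : G →* Q), f g ≠ 1) :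
    ResiduallyFinite G := by
  intro g hg
  obtain ⟨Q, _, _, f, hf⟩ := h g hg
  have : Small.{0} Q := small_of_injective (Finite.equivFin Q).injective
  refine ⟨Shrink.{0} Q, inferInstance, Finite.of_equiv Q (equivShrink Q),
    (Shrink.mulEquiv (α := Q)).symm.toMonoidHom.comp f, ?_⟩
  simpa using hf

theorem of_finite {G : Type*} [Group G] [Finite G] : ResiduallyFinite G :=
  of_forall_exists_hom fun _ hg => ⟨G, inferInstance, inferInstance, MonoidHom.id G, hg⟩

theorem of_injective {G K : Type*} [Group G] [Group K] (hK : ResiduallyFinite K) (f : G →* K)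
    (hf : Function.Injective f) : ResiduallyFinite G := by
  intro g hg
  obtain ⟨Q, i, j, e, he⟩ := hK (f g) (by rwa [Ne, map_eq_one_iff f hf])
  exact ⟨Q, i, j, e.comp f, he⟩

theorem multiplicative_int : ResiduallyFinite (Multiplicative ℤ) := by
  intro g hg
  have hg' : g.toAdd ≠ 0 := hg
  have hne : NeZero (g.toAdd.natAbs + 1) := ⟨by lia⟩
  refine ⟨Multiplicative (ZMod (g.toAdd.natAbs + 1)), inferInstance, ?_,
    (Int.castAddHom (ZMod (g.toAdd.natAbs + 1))).toMultiplicative, ?_⟩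
  · exact inferInstanceAs (Finite (ZMod (g.toAdd.natAbs + 1)))
  · intro h
    have h0 : ((g.toAdd : ℤ) : ZMod (g.toAdd.natAbs + 1)) = 0 := h
    rw [ZMod.intCast_zmod_eq_zero_iff_dvd] at h0
    have := Int.natAbs_dvd_natAbs.2 h0
    have := Nat.le_of_dvd (by lia) this
    simp only [Int.natAbs_natCast] at this
    lia

end ResiduallyFinite

section TruncatedAction

open CoprodI

variable {ι : Type*} {K : ι → Type*} [∀ i, Group (K i)] [DecidableEq ι] [∀ i, DecidableEq (K i)]

/-- The action of a factor of a free product on reduced words, truncated so that words never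
become longer than `n`. -/
def truncSmul (n : ℕ) {i : ι} (m : K i) (w : Word K) : Word K :=
  if (Word.equivPair i w).tail.toList.length < n then CoprodI.of m • w else w

theorem equivPair_truncSmul_tail (n : ℕ) {i : ι} (m : K i) (w : Word K) :
    (Word.equivPair i (truncSmul n m w)).tail = (Word.equivPair i w).tail := by
  unfold truncSmul
  split_ifs
  · rw [Word.equivPair_smul_same]
  · rfl

theorem one_truncSmul (n : ℕ) {i : ι} (w : Word K) : truncSmul n (1 : K i) w = w := by
  unfold truncSmul
  split_ifs <;> simp

theorem mul_truncSmul (n : ℕ) {i : ι} (m m' : K i) (w : Word K) :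
    truncSmul n (m * m') w = truncSmul n m (truncSmul n m' w) := by
  conv_rhs => rw [truncSmul, equivPair_truncSmul_tail]
  unfold truncSmul
  split_ifs
  · rw [map_mul, mul_smul]
  · rfl

theorem length_truncSmul_le (n : ℕ) {i : ι} (m : K i) (w : Word K) (hw : w.toList.length ≤ n) :
    (truncSmul n m w).toList.length ≤ n := by
  unfold truncSmul
  split_ifs with h
  · rw [Word.of_smul_def, Word.rcons]
    split_ifs
    · exact h.le
    · simpa using h
  · exact hw

/-- The truncated action of a free product on reduced words of length at most `n`. -/
def truncHom (K : ι → Type*) [∀ i, Group (K i)] [∀ i, DecidableEq (K i)] (n : ℕ) :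
    CoprodI K →* Equiv.Perm {w : Word K // w.toList.length ≤ n} :=
  CoprodI.lift fun _ => MonoidHom.toHomPerm
    { toFun m w := ⟨truncSmul n m w.1, length_truncSmul_le n m w.1 w.2⟩
      map_one' := funext fun w => Subtype.ext (one_truncSmul n w.1)
      map_mul' m m' := funext fun w => Subtype.ext (mul_truncSmul n m m' w.1) }

theorem truncHom_prod_empty (n : ℕ) (w : Word K) (hw : w.toList.length ≤ n) :
    (truncHom K n w.prod ⟨Word.empty, Nat.zero_le n⟩).1 = w := by
  induction w using Word.consRecOn with
  | empty => simp
  | cons i m w h1 h2 ih =>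
    simp only [Word.cons_toList, List.length_cons] at hw
    have ih := ih (by lia)
    rw [Word.prod_cons, map_mul, Equiv.Perm.mul_apply]
    have key : ∀ y : {w : Word K // w.toList.length ≤ n},
        (truncHom K n (CoprodI.of m) y).1 = truncSmul n m y.1 := by
      intro y
      rw [truncHom, CoprodI.lift_of]
      rfl
    rw [key, ih, truncSmul, Word.equivPair_eq_of_fstIdx_ne h1, if_pos (by simpa using hw),
      Word.of_smul_def, Word.equivPair_eq_of_fstIdx_ne h1, Word.rcons, dif_neg (by simpa using h2)]
    simp

end TruncatedAction

theorem Monoid.CoprodI.finite_word_length_le {ι : Type*} {K : ι → Type*} [∀ i, Group (K i)]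
    [Finite {p : Σ i, K i // p.2 ≠ 1}] (n : ℕ) :
    Finite {w : CoprodI.Word K // w.toList.length ≤ n} := by
  let A := {p : Σ i, K i // p.2 ≠ 1}
  have hfin : Finite {l : List A // l.length ≤ n} := List.finite_length_le A n
  refine Finite.of_injective (β := {l : List A // l.length ≤ n})
    (fun w => ⟨w.1.toList.attach.map fun p => ⟨p.1, w.1.ne_one p.1 p.2⟩, by simpa using w.2⟩) ?_
  intro w w' h
  apply Subtype.ext
  apply CoprodI.Word.ext
  have := congrArg (List.map Subtype.val) (congrArg Subtype.val h)
  simpa [Function.comp_def] using this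

namespace ResiduallyFinite

open CoprodI

open scoped Classical in
/-- A free product of residually finite groups is residually finite. -/
theorem coprodI {ι : Type*} {G : ι → Type*} [∀ i, Group (G i)]
    (hG : ∀ i, ResiduallyFinite (G i)) : ResiduallyFinite (CoprodI G) := by
  apply of_forall_exists_hom
  intro g hg
  obtain ⟨w, rfl⟩ : ∃ w : Word G, w.prod = g := ⟨Word.equiv g, Word.equiv.symm_apply_apply g⟩
  choose Q hQ hfin f hf using hG
  let T : ι → Type _ := fun i => {m : G i // (⟨i, m⟩ : Σ i, G i) ∈ w.toList}
  have hT : ∀ i, Finite (T i) := fun i =>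
    Finite.of_injective (β := {p // p ∈ w.toList}) (fun m => ⟨⟨i, m.1⟩, m.2⟩) fun a b h => by
      apply Subtype.ext
      simpa using h
  have hT1 : ∀ i (m : T i), m.1 ≠ 1 := fun i m => w.ne_one _ m.2
  let K : ι → Type _ := fun i => ∀ m : T i, Q i m.1 (hT1 i m)
  have hK : ∀ i, Finite (K i) := fun i => inferInstance
  let F : ∀ i, G i →* K i := fun i => MonoidHom.pi fun m : T i => f i m.1 (hT1 i m)
  have hF : ∀ i (m : G i), (⟨i, m⟩ : Σ i, G i) ∈ w.toList → F i m ≠ 1 := by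
    intro i m hm h
    exact hf i m (hT1 i ⟨m, hm⟩) (congrFun h ⟨m, hm⟩)
  let v : Word K :=
    { toList := w.toList.map fun p => ⟨p.1, F p.1 p.2⟩
      ne_one := by
        intro l hl
        obtain ⟨p, hp, rfl⟩ := List.mem_map.1 hl
        exact hF p.1 p.2 hp
      chain_ne := by simpa [List.isChain_map] using w.chain_ne }
  have hv : CoprodI.lift (fun i => CoprodI.of.comp (F i)) w.prod = v.prod := by
    simp [Word.prod, v, map_list_prod, Function.comp_def]
  have hfin' : Finite {p : Σ i, K i // p.2 ≠ 1} := by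
    have hsupp : Finite {i : ι // Nonempty (T i)} := by
      refine Finite.of_surjective (α := {p // p ∈ w.toList}) (fun p => ⟨p.1.1, ⟨p.1.2, p.2⟩⟩) ?_
      rintro ⟨i, ⟨m, hm⟩⟩
      exact ⟨⟨⟨i, m⟩, hm⟩, rfl⟩
    have hne : ∀ p : {p : Σ i, K i // p.2 ≠ 1}, Nonempty (T p.1.1) := by
      intro p
      by_contra hp
      have := not_nonempty_iff.1 hp
      exact p.2 (Subsingleton.elim _ _)
    refine Finite.of_injective (β := Σ i : {i : ι // Nonempty (T i)}, K i.1)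
      (fun p => ⟨⟨p.1.1, hne p⟩, p.1.2⟩) ?_
    rintro ⟨⟨i, k⟩, hp⟩ ⟨⟨i', k'⟩, hp'⟩ h
    simp only [Sigma.mk.injEq, Subtype.mk.injEq] at h
    obtain ⟨rfl, h⟩ := h
    simpa using h
  have := finite_word_length_le (K := K) v.toList.length
  refine ⟨Equiv.Perm {u : Word K // u.toList.length ≤ v.toList.length}, inferInstance,
    inferInstance, (truncHom K v.toList.length).comp
      (CoprodI.lift fun i => CoprodI.of.comp (F i)), ?_⟩
  intro h
  have h1 := truncHom_prod_empty _ v le_rfl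
  rw [← hv, ← MonoidHom.comp_apply, h] at h1
  have h2 : w.toList = [] := by
    have := congrArg (fun u : Word K => u.toList) h1
    simpa [v] using this.symm
  exact hg (by simp [Word.prod, h2])

/-- Free groups are residually finite. -/
theorem freeGroup (X : Type*) : ResiduallyFinite (FreeGroup X) := by
  have hZ : ResiduallyFinite (FreeGroup Unit) :=
    of_injective multiplicative_int FreeGroup.mulEquivIntOfUnique.toMonoidHom
      FreeGroup.mulEquivIntOfUnique.injective
  exact of_injective (coprodI fun _ : X => hZ) freeGroupEquivCoprodI.toMonoidHom
    freeGroupEquivCoprodI.injective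

theorem prod {A B : Type*} [Group A] [Group B] (hA : ResiduallyFinite A)
    (hB : ResiduallyFinite B) : ResiduallyFinite (A × B) := by
  intro g hg
  by_cases h : g.1 = 1
  · obtain ⟨Q, i, j, f, hf⟩ := hB g.2 fun h' => hg (Prod.ext h h')
    exact ⟨Q, i, j, f.comp (MonoidHom.snd A B), hf⟩
  · obtain ⟨Q, i, j, f, hf⟩ := hA g.1 h
    exact ⟨Q, i, j, f.comp (MonoidHom.fst A B), hf⟩

/-- The free product of two residually finite groups is residually finite. -/
theorem coprod {A B : Type*} [Group A] [Group B] (hA : ResiduallyFinite A)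
    (hB : ResiduallyFinite B) : ResiduallyFinite (Coprod A B) := by
  let emb : Coprod A B →* CoprodI fun _ : Bool => A × B :=
    Coprod.lift ((CoprodI.of (M := fun _ : Bool => A × B) (i := true)).comp (MonoidHom.inl A B))
      ((CoprodI.of (M := fun _ : Bool => A × B) (i := false)).comp (MonoidHom.inr A B))
  let back : (CoprodI fun _ : Bool => A × B) →* Coprod A B :=
    CoprodI.lift fun i => cond i (Coprod.inl.comp (MonoidHom.fst A B))
      (Coprod.inr.comp (MonoidHom.snd A B))
  have hcomp : back.comp emb = MonoidHom.id _ := by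
    apply Coprod.hom_ext <;> ext <;> simp [back, emb]
  exact of_injective (coprodI fun _ : Bool => prod hA hB) emb
    (Function.LeftInverse.injective (g := back) (DFunLike.congr_fun hcomp))

end ResiduallyFinite

/-- A translation-indexed family of conditions `Rel i` on bi-infinite sequences, where `Rel i`
involves only the terms with index in `[i + lo, i + hi]` and can be solved uniquely for the term
of index `i + hi` as well as for the term of index `i + lo`. -/
structure IsTwoSidedRecursion {Q : Type*} (Rel : ℤ → (ℤ → Q) → Prop) (lo hi : ℤ) : Prop where
  le : lo ≤ hi
  congr : ∀ i u v, (∀ j, i + lo ≤ j → j ≤ i + hi → u j = v j) → Rel i u → Rel i v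
  existsUnique_hi : ∀ i u, ∃! q, Rel i (Function.update u (i + hi) q)
  existsUnique_lo : ∀ i u, ∃! q, Rel i (Function.update u (i + lo) q)

namespace IsTwoSidedRecursion

variable {Q : Type*} {Rel : ℤ → (ℤ → Q) → Prop} {lo hi : ℤ}

theorem reflect (h : IsTwoSidedRecursion Rel lo hi) :
    IsTwoSidedRecursion (fun i u => Rel (-i) fun j => u (-j)) (-hi) (-lo) where
  le := neg_le_neg h.le
  congr i u v huv := h.congr _ _ _ fun j h1 h2 => huv _ (by lia) (by lia)
  existsUnique_hi i u := by
    convert h.existsUnique_lo (-i) fun j => u (-j) using 4 with q j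
    simp only [Function.update_apply]
    congr 1
    rw [eq_iff_iff]
    constructor <;> intro <;> lia
  existsUnique_lo i u := by
    convert h.existsUnique_hi (-i) fun j => u (-j) using 4 with q j
    simp only [Function.update_apply]
    congr 1
    rw [eq_iff_iff]
    constructor <;> intro <;> lia

theorem exists_extension_ge (h : IsTwoSidedRecursion Rel lo hi) (i₀ : ℤ) (u₀ : ℤ → Q) :
    ∃ u : ℤ → Q, (∀ j < i₀ + hi, u j = u₀ j) ∧ ∀ i, i₀ ≤ i → Rel i u := by
  choose sol hsol _ using h.existsUnique_hi
  let U : ℕ → ℤ → Q := fun n => n.rec u₀ fun n u =>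
    Function.update u (i₀ + n + hi) (sol (i₀ + n) u)
  have hU : ∀ n, U (n + 1) = Function.update (U n) (i₀ + n + hi) (sol (i₀ + n) (U n)) :=
    fun _ => rfl
  have hstable : ∀ m n : ℕ, ∀ j < i₀ + n + hi, U (n + m) j = U n j := by
    intro m n j hj
    induction m with
    | zero => rfl
    | succ m ih => rw [← add_assoc, hU, Function.update_of_ne (by push_cast; lia), ih]
  have hlim : ∀ n : ℕ, ∀ j < i₀ + n + hi, U ((j - (i₀ + hi)).toNat + 1) j = U n j := by
    intro n j hj
    rcases le_total ((j - (i₀ + hi)).toNat + 1) n with hn | hn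
    · obtain ⟨m, rfl⟩ := Nat.exists_eq_add_of_le hn
      exact (hstable m ((j - (i₀ + hi)).toNat + 1) j (by lia)).symm
    · obtain ⟨m, hm⟩ := Nat.exists_eq_add_of_le hn
      rw [hm]
      exact hstable m n j hj
  refine ⟨fun j => U ((j - (i₀ + hi)).toNat + 1) j, fun j hj => hlim 0 j (by simpa using hj),
    fun i hi' => ?_⟩
  obtain ⟨n, rfl⟩ : ∃ n : ℕ, i = i₀ + n := ⟨(i - i₀).toNat, by lia⟩
  refine h.congr _ (U (n + 1)) _ (fun j _ h2 => (hlim (n + 1) j (by push_cast; lia)).symm) ?_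
  rw [hU]
  exact hsol _ _

theorem eq_hi (h : IsTwoSidedRecursion Rel lo hi) {i : ℤ} {u v : ℤ → Q} (hu : Rel i u)
    (hv : Rel i v) (huv : ∀ j, i + lo ≤ j → j < i + hi → u j = v j) :
    u (i + hi) = v (i + hi) := by
  refine (h.existsUnique_hi i u).unique (by rwa [Function.update_eq_self]) ?_
  refine h.congr i v _ (fun j h1 h2 => ?_) hv
  rcases h2.eq_or_lt with rfl | h2
  · simp
  · rw [Function.update_of_ne h2.ne, huv j h1 h2]

theorem eq_of_ge (h : IsTwoSidedRecursion Rel lo hi) {u v : ℤ → Q} (hu : ∀ i, Rel i u)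
    (hv : ∀ i, Rel i v) (huv : ∀ j, lo ≤ j → j < hi → u j = v j) (j : ℤ) (hj : lo ≤ j) :
    u j = v j := by
  have key : ∀ n : ℕ, ∀ j, lo ≤ j → j < hi + n → u j = v j := by
    intro n
    induction n with
    | zero => simpa using huv
    | succ n ih =>
      intro j h1 h2
      by_cases h3 : j < hi + n
      · exact ih j h1 h3
      · obtain rfl : j = n + hi := by push_cast at h2; lia
        exact h.eq_hi (hu n) (hv n) fun j h4 h5 => ih j (by lia) (by lia)
  exact key (j - hi + 1).toNat j hj (by lia)

theorem exists_solution (h : IsTwoSidedRecursion Rel lo hi) (i₀ : ℤ) (u₀ : ℤ → Q) :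
    ∃ u : ℤ → Q, (∀ j, i₀ + lo ≤ j → j < i₀ + hi → u j = u₀ j) ∧ ∀ i, Rel i u := by
  obtain ⟨u, hu, hRel⟩ := h.exists_extension_ge i₀ u₀
  obtain ⟨v, hv, hRel'⟩ := h.reflect.exists_extension_ge (1 - i₀) fun j => u (-j)
  have hvu : ∀ j, i₀ + lo ≤ j → v (-j) = u j := fun j hj => by
    rw [hv (-j) (by lia), neg_neg]
  refine ⟨fun j => v (-j), fun j h1 h2 => (hvu j h1).trans (hu j h2), fun i => ?_⟩
  rcases le_or_gt i₀ i with hi' | hi'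
  · exact h.congr i u _ (fun j h1 _ => (hvu j (by lia)).symm) (hRel i hi')
  · simpa using hRel' (-i) (by lia)

theorem eq_of_solutions (h : IsTwoSidedRecursion Rel lo hi) {u v : ℤ → Q} (hu : ∀ i, Rel i u)
    (hv : ∀ i, Rel i v) (huv : ∀ j, lo ≤ j → j < hi → u j = v j) : u = v := by
  have hge := h.eq_of_ge hu hv huv
  have hle := h.reflect.eq_of_ge (u := fun j => u (-j)) (v := fun j => v (-j))
    (fun i => by simpa using hu (-i)) (fun i => by simpa using hv (-i))
    fun j h1 h2 => hge (-j) (by lia)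
  ext j
  rcases le_total lo j with hj | hj
  · exact hge j hj
  · simpa using hle (-j) (by have := h.le; lia)

theorem finite_solutions [Finite Q] (h : IsTwoSidedRecursion Rel lo hi) :
    {u : ℤ → Q | ∀ i, Rel i u}.Finite := by
  refine Set.Finite.of_injOn (f := fun u (j : Set.Ico lo hi) => u j) (t := Set.univ)
    (fun _ _ => Set.mem_univ _) (fun u hu v hv huv => ?_) Set.finite_univ
  exact h.eq_of_solutions hu hv fun j h1 h2 => congrFun huv ⟨j, h1, h2⟩

end IsTwoSidedRecursion

section Paths

variable {X H Q : Type*} [Group H] [Group Q]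

/-- The weight `ε θ(x)` of a signed letter `x ^ ε`. -/
def signedWeight (θ : X → ℤ) (p : X × Bool) : ℤ := if p.2 then θ p.1 else -θ p.1

/-- `y` or `y⁻¹`, according to the sign `ε`. -/
def signedPow (ε : Bool) (y : Q) : Q := if ε then y else y⁻¹

theorem signedPow_injective (ε : Bool) : Function.Injective (signedPow ε : Q → Q) := by
  cases ε
  · exact inv_injective
  · exact fun _ _ h => h

theorem signedPow_signedPow (ε : Bool) (y : Q) : signedPow ε (signedPow ε y) = y := by
  cases ε <;> simp [signedPow]

theorem map_signedPow {Q' : Type*} [Group Q'] (π : Q →* Q') (ε : Bool) (y : Q) :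
    π (signedPow ε y) = signedPow ε (π y) := by
  cases ε <;> simp [signedPow]

theorem phiW_zero (θ : X → ℤ) (W : List (X × Bool)) : phiW θ W 0 = 0 := rfl

theorem phiW_cons_succ (θ : X → ℤ) (p : X × Bool) (W : List (X × Bool)) (j : ℕ) :
    phiW θ (p :: W) (j + 1) = signedWeight θ p + phiW θ W j := rfl

theorem phiW_succ (θ : X → ℤ) (W : List (X × Bool)) (j : ℕ) (hj : j < W.length) :
    phiW θ W (j + 1) = phiW θ W j + signedWeight θ W[j] := by
  induction W generalizing j with
  | nil => simp at hj
  | cons p W ih =>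
    cases j with
    | zero => simp [phiW_cons_succ, phiW_zero]
    | succ j => rw [phiW_cons_succ, phiW_cons_succ, ih j (by simpa using hj), add_assoc]; rfl

/-- The lower end of the edge traversed by the letter in position `j` of the word `W`, when `W` is
read as a path on `ℤ` starting at `0` in which `x ^ ε` is a step of length `ε θ(x)`. -/
def lowerEnd (θ : X → ℤ) (W : List (X × Bool)) (j : ℕ) : ℤ :=
  min (phiW θ W j) (phiW θ W (j + 1))

theorem lowerEnd_cons_zero (θ : X → ℤ) (p : X × Bool) (W : List (X × Bool)) :
    lowerEnd θ (p :: W) 0 = min 0 (signedWeight θ p) := by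
  simp [lowerEnd, phiW_cons_succ, phiW_zero]

theorem lowerEnd_cons_succ (θ : X → ℤ) (p : X × Bool) (W : List (X × Bool)) (j : ℕ) :
    lowerEnd θ (p :: W) (j + 1) = signedWeight θ p + lowerEnd θ W j := by
  simp [lowerEnd, phiW_cons_succ, min_add_add_left]

/-- The value of a path starting at level `i`, where the edge labelled `x` with lower end `v` is
given the value `β v x` and the elements of `H` are evaluated by `f`. -/
def pathValue (θ : X → ℤ) (f : Coprod H (FreeGroup X) →* Q) (β : ℤ → X → Q) :
    ℤ → List (X × Bool × H) → Q
  | _, [] => 1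
  | i, t :: L =>
    signedPow t.2.1 (β (i + min 0 (signedWeight θ (t.1, t.2.1))) t.1) * f (Coprod.inl t.2.2) *
      pathValue θ f β (i + signedWeight θ (t.1, t.2.1)) L

variable (θ : X → ℤ) (f : Coprod H (FreeGroup X) →* Q)

theorem pathValue_congr (L : List (X × Bool × H)) (i : ℤ) (β β' : ℤ → X → Q)
    (h : ∀ (j : ℕ) (hj : j < L.length),
      β (i + lowerEnd θ (skel L) j) L[j].1 = β' (i + lowerEnd θ (skel L) j) L[j].1) :
    pathValue θ f β i L = pathValue θ f β' i L := by
  induction L generalizing i with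
  | nil => rfl
  | cons t L ih =>
    have h0 := h 0 (by simp)
    simp only [skel, List.map_cons, lowerEnd_cons_zero, List.getElem_cons_zero] at h0
    simp only [pathValue]
    rw [h0, ih]
    intro j hj
    have := h (j + 1) (by simpa using hj)
    simpa only [skel, List.map_cons, lowerEnd_cons_succ, List.getElem_cons_succ, add_assoc]
      using this

/-- The value of a path as a function of the value of a single edge. -/
theorem exists_pathValue_eq (L : List (X × Bool × H)) (i : ℤ) (k : ℕ) (hk : k < L.length)
    (β : ℤ → X → Q) :
    ∃ P S : Q, ∀ β' : ℤ → X → Q,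
      (∀ (j : ℕ) (hj : j < L.length), j ≠ k →
        β' (i + lowerEnd θ (skel L) j) L[j].1 = β (i + lowerEnd θ (skel L) j) L[j].1) →
      pathValue θ f β' i L =
        P * signedPow L[k].2.1 (β' (i + lowerEnd θ (skel L) k) L[k].1) * S := by
  induction L generalizing i k with
  | nil => simp at hk
  | cons t L ih =>
    cases k with
    | zero =>
      refine ⟨1, f (Coprod.inl t.2.2) * pathValue θ f β (i + signedWeight θ (t.1, t.2.1)) L,
        fun β' h => ?_⟩
      simp only [pathValue, skel, List.map_cons, lowerEnd_cons_zero, List.getElem_cons_zero,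
        one_mul, mul_assoc]
      rw [pathValue_congr θ f L _ β' β]
      intro j hj
      have := h (j + 1) (by simpa using hj) (by simp)
      simpa only [skel, List.map_cons, lowerEnd_cons_succ, List.getElem_cons_succ, add_assoc]
        using this
    | succ k =>
      obtain ⟨P, S, hPS⟩ := ih (i + signedWeight θ (t.1, t.2.1)) k (by simpa using hk)
      refine ⟨signedPow t.2.1 (β (i + min 0 (signedWeight θ (t.1, t.2.1))) t.1) *
        f (Coprod.inl t.2.2) * P, S, fun β' h => ?_⟩
      have h0 := h 0 (by simp) (by simp)
      simp only [skel, List.map_cons, lowerEnd_cons_zero, List.getElem_cons_zero] at h0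
      have h1 := hPS β' fun j hj hjk => by
        have := h (j + 1) (by simpa using hj) (by simpa using hjk)
        simpa only [skel, List.map_cons, lowerEnd_cons_succ, List.getElem_cons_succ, add_assoc]
          using this
      simp only [pathValue, h0, h1, skel, List.map_cons, lowerEnd_cons_succ,
        List.getElem_cons_succ, add_assoc, mul_assoc]

theorem pathValue_add (β : ℤ → X → Q) (L : List (X × Bool × H)) (i c : ℤ) :
    pathValue θ f β (i + c) L = pathValue θ f (fun v => β (v + c)) i L := by
  induction L generalizing i with
  | nil => rfl
  | cons t L ih => simp only [pathValue, ← ih, add_right_comm _ _ c]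

theorem map_pathValue {Q' : Type*} [Group Q'] (π : Q →* Q') (β : ℤ → X → Q)
    (L : List (X × Bool × H)) (i : ℤ) :
    π (pathValue θ f β i L) = pathValue θ (π.comp f) (fun v x => π (β v x)) i L := by
  induction L generalizing i with
  | nil => simp [pathValue]
  | cons t L ih => simp [pathValue, ← ih, map_signedPow]

theorem freeGroup_mk_singleton (x : X) (ε : Bool) :
    FreeGroup.mk [(x, ε)] = signedPow ε (FreeGroup.of x) := by
  cases ε <;> rfl

theorem relWord_cons (t : X × Bool × H) (L : List (X × Bool × H)) :
    relWord (t :: L) =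
      signedPow t.2.1 (Coprod.inr (FreeGroup.of t.1)) * Coprod.inl t.2.2 * relWord L := by
  simp [relWord, freeGroup_mk_singleton, map_signedPow]

theorem pathValue_const (L : List (X × Bool × H)) (i : ℤ) :
    pathValue θ f (fun _ x => f (Coprod.inr (FreeGroup.of x))) i L = f (relWord L) := by
  induction L generalizing i with
  | nil => simp [pathValue, relWord]
  | cons t L ih => simp [pathValue, relWord_cons, ih, map_signedPow]

theorem exists_eq_inl_mul_relWord (g : Coprod H (FreeGroup X)) :
    ∃ (h : H) (L : List (X × Bool × H)), g = Coprod.inl h * relWord L := by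
  induction g using Coprod.induction_on' with
  | one => exact ⟨1, [], by simp [relWord]⟩
  | inl_mul h g ih =>
    obtain ⟨h', L, rfl⟩ := ih
    exact ⟨h * h', L, by simp [mul_assoc]⟩
  | inr_mul w g ih =>
    induction w using FreeGroup.induction_on generalizing g with
    | C1 => simpa using ih
    | of x =>
      obtain ⟨h', L, rfl⟩ := ih
      exact ⟨1, (x, true, h') :: L, by simp [relWord_cons, signedPow, mul_assoc]⟩
    | inv_of x _ =>
      obtain ⟨h', L, rfl⟩ := ih
      exact ⟨1, (x, false, h') :: L, by simp [relWord_cons, signedPow, mul_assoc]⟩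
    | mul w w' ihw ihw' =>
      rw [map_mul, mul_assoc]
      exact ihw _ (ihw' _ ih)

end Paths

section PathAction

variable {X H Q : Type*} (E : Set (ℤ → X → Q)) (hE : ∀ β ∈ E, ∀ c : ℤ, (fun v => β (v + c)) ∈ E)

/-- Translation on a translation-invariant set of edge labellings. -/
def shiftLabelling (c : ℤ) (β : E) : E := ⟨fun v => β.1 (v + c), hE β.1 β.2 c⟩

theorem shiftLabelling_shiftLabelling (c d : ℤ) (β : E) :
    shiftLabelling E hE c (shiftLabelling E hE d β) = shiftLabelling E hE (c + d) β := by
  apply Subtype.ext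
  funext v
  simp [shiftLabelling, add_assoc]

theorem shiftLabelling_zero (β : E) : shiftLabelling E hE 0 β = β := by
  apply Subtype.ext
  funext v
  simp [shiftLabelling]

variable [Group H] [Group Q] (θ : X → ℤ) (f : Coprod H (FreeGroup X) →* Q)

/-- The permutation of `Q × E` through which a letter acts. -/
def letterPerm (x : X) : Equiv.Perm (Q × E) where
  toFun s :=
    ((shiftLabelling E hE (-θ x) s.2).1 (min 0 (θ x)) x * s.1, shiftLabelling E hE (-θ x) s.2)
  invFun s := ((s.2.1 (min 0 (θ x)) x)⁻¹ * s.1, shiftLabelling E hE (θ x) s.2)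
  left_inv s := by simp [shiftLabelling_shiftLabelling, shiftLabelling_zero]
  right_inv s := by simp [shiftLabelling_shiftLabelling, shiftLabelling_zero]

theorem letterPerm_inv_apply (x : X) (s : Q × E) :
    (letterPerm E hE θ x)⁻¹ s =
      ((s.2.1 (min 0 (θ x)) x)⁻¹ * s.1, shiftLabelling E hE (θ x) s.2) :=
  rfl

/-- The permutation of `Q × E` through which an element of `H` acts. -/
def coeffPerm : H →* Equiv.Perm (Q × E) where
  toFun h := (Equiv.mulLeft (f (Coprod.inl h))).prodCongr (Equiv.refl E)
  map_one' := by ext s <;> simp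
  map_mul' h h' := by ext s <;> simp [mul_assoc]

/-- The action of `H ∗ F(X)` on `Q × E`. -/
def pathAction : Coprod H (FreeGroup X) →* Equiv.Perm (Q × E) :=
  Coprod.lift (coeffPerm E f) (FreeGroup.lift (letterPerm E hE θ))

theorem pathAction_relWord (L : List (X × Bool × H)) (s : Q) (β : E) :
    pathAction E hE θ f (relWord L) (s, shiftLabelling E hE (phiW θ (skel L) L.length) β) =
      (pathValue θ f β.1 0 L * s, β) := by
  induction L generalizing s β with
  | nil => simp [relWord, pathValue, skel, phiW_zero, shiftLabelling_zero]
  | cons t L ih =>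
    obtain ⟨x, ε, h⟩ := t
    have hlen : phiW θ (skel ((x, ε, h) :: L)) (L.length + 1) =
      phiW θ (skel L) L.length + signedWeight θ (x, ε) := by
      rw [skel, List.map_cons, phiW_cons_succ, add_comm]; rfl
    rw [List.length_cons, hlen, ← shiftLabelling_shiftLabelling, relWord_cons, map_mul, map_mul,
      Equiv.Perm.mul_apply, ih, Equiv.Perm.mul_apply]
    have h1 : pathValue θ f (shiftLabelling E hE (signedWeight θ (x, ε)) β).1 0 L =
        pathValue θ f β.1 (0 + signedWeight θ (x, ε)) L :=
      (pathValue_add θ f β.1 L 0 _).symm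
    rw [h1, map_signedPow]
    cases ε
    · simp only [signedWeight, signedPow, pathValue, pathAction, Coprod.lift_apply_inl,
        Coprod.lift_apply_inr, FreeGroup.lift_apply_of, coeffPerm, MonoidHom.coe_mk]
      have h2 : (shiftLabelling E hE (-θ x) β).1 (min 0 (θ x)) x = β.1 (min 0 (-θ x)) x := by
        change β.1 (min 0 (θ x) + -θ x) x = _
        rw [← min_add_add_right, zero_add, add_neg_cancel, min_comm]
      simp [letterPerm_inv_apply, shiftLabelling_shiftLabelling, shiftLabelling_zero, mul_assoc,
        h2]
    · simp only [signedWeight, signedPow, pathValue, pathAction, Coprod.lift_apply_inl,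
        Coprod.lift_apply_inr, FreeGroup.lift_apply_of, coeffPerm, MonoidHom.coe_mk]
      simp [letterPerm, shiftLabelling_shiftLabelling, shiftLabelling_zero, mul_assoc]

/-- If every labelling in `E` satisfies the relator `R`, the action on `Q × E` factors through the
group defined by `R`; an element acting trivially has trivial value for every labelling. -/
theorem exists_relGroup_hom (hE : ∀ β ∈ E, ∀ c : ℤ, (fun v => β (v + c)) ∈ E)
    (R : List (X × Bool × H)) (hθ : IsAdmissible θ (skel R))
    (hR : ∀ β ∈ E, pathValue θ f β 0 R = 1) :
    ∃ Φ : relGroup R →* Equiv.Perm (Q × E), ∀ (h : H) (L : List (X × Bool × H)), ∀ β ∈ E,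
      Φ (QuotientGroup.mk' _ (Coprod.inl h * relWord L)) = 1 →
        f (Coprod.inl h) * pathValue θ f β 0 L = 1 := by
  have hker : Subgroup.normalClosure {relWord R} ≤ (pathAction E hE θ f).ker := by
    apply Subgroup.normalClosure_le_normal
    rw [Set.singleton_subset_iff, SetLike.mem_coe, MonoidHom.mem_ker]
    ext1 s
    have h := pathAction_relWord E hE θ f R s.1 s.2
    have hθ' : phiW θ (skel R) R.length = 0 := by
      simpa [IsAdmissible, skel] using hθ
    rwa [hθ', shiftLabelling_zero, hR _ s.2.2, one_mul] at h
  refine ⟨QuotientGroup.lift _ (pathAction E hE θ f) hker, fun h L β hβ hone => ?_⟩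
  have hone' : pathAction E hE θ f (Coprod.inl h * relWord L) = 1 := hone
  have key := pathAction_relWord E hE θ f L 1 ⟨β, hβ⟩
  have := congrArg
    (fun σ => (σ (1, shiftLabelling E hE (phiW θ (skel L) L.length) ⟨β, hβ⟩)).1) hone'
  rw [map_mul] at this
  simp only [Equiv.Perm.mul_apply, key] at this
  simpa [pathAction, coeffPerm] using this

end PathAction

/-- The positions `k` and `l` of the letters ending at the unique maximum and the unique minimum
of the graph of the skeleton of `R`, described through the lower ends of the edges. -/
structure IsExtremalPair {X H : Type*} (θ : X → ℤ) (R : List (X × Bool × H))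
    (k l : Fin R.length) : Prop where
  weight_pos : 0 < |θ R[k.1].1|
  lt_top : ∀ j : Fin R.length,
    lowerEnd θ (skel R) j < lowerEnd θ (skel R) k + |θ R[k.1].1|
  lt_of_ne : ∀ j : Fin R.length, j ≠ k → R[j.1].1 = R[k.1].1 →
    lowerEnd θ (skel R) j < lowerEnd θ (skel R) k
  le : ∀ j : Fin R.length, lowerEnd θ (skel R) l ≤ lowerEnd θ (skel R) j
  lt_of_ne' : ∀ j : Fin R.length, j ≠ l → R[j.1].1 = R[l.1].1 →
    lowerEnd θ (skel R) l < lowerEnd θ (skel R) j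

theorem exists_succIdx_eq {X : Type*} {θ : X → ℤ} {W : List (X × Bool)} (hθ : IsAdmissible θ W)
    (j : Fin W.length) :
    ∃ i : Fin W.length, succIdx W i = j ∧ phiW θ W (i.1 + 1) = phiW θ W j := by
  obtain ⟨j, hj⟩ := j
  cases j with
  | zero =>
    refine ⟨⟨W.length - 1, by lia⟩, ?_, ?_⟩
    · simp [succIdx, Nat.sub_add_cancel (show 1 ≤ W.length from hj)]
    · simpa [Nat.sub_add_cancel (show 1 ≤ W.length from hj), phiW_zero, IsAdmissible] using hθ
  | succ j => exact ⟨⟨j, by lia⟩, by simp [succIdx, Nat.mod_eq_of_lt hj], rfl⟩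

theorem UniqueMaxMinWith.exists_isExtremalPair {X H : Type*} {θ : X → ℤ}
    {R : List (X × Bool × H)} (h : UniqueMaxMinWith θ (skel R)) :
    ∃ k l, IsExtremalPair θ R k l := by
  obtain ⟨-, -, hs, hθ, k, l, hk, hl, hkx, hlx⟩ := h
  have hlen : (skel R).length = R.length := by simp [skel]
  have hget : ∀ j : Fin (skel R).length, ((skel R).get j).1 = (R[j.1]'(hlen ▸ j.2)).1 :=
    fun _ => congrArg Prod.fst (List.getElem_map _)
  have hsucc : ∀ j : Fin (skel R).length,
      phiW θ (skel R) (j + 1) = phiW θ (skel R) j + θ ((skel R).get j).1 ∨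
      phiW θ (skel R) (j + 1) = phiW θ (skel R) j - θ ((skel R).get j).1 := by
    intro j
    rw [phiW_succ θ _ _ j.2, signedWeight]
    split_ifs
    · exact Or.inl rfl
    · exact Or.inr rfl
  have hstep : ∀ j : Fin (skel R).length,
      max (phiW θ (skel R) j) (phiW θ (skel R) (j + 1)) =
        lowerEnd θ (skel R) j + |θ ((skel R).get j).1| := by
    intro j
    have := hsucc j
    rw [lowerEnd]
    grind
  have hpos : ∀ x, 0 < |θ x| := fun x => abs_pos.2 (hs x)
  have hup : ∀ j, succIdx (skel R) k ≠ j → phiW θ (skel R) j < phiW θ (skel R) (k + 1) := by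
    intro j hj
    obtain ⟨i, rfl, hij⟩ := exists_succIdx_eq hθ j
    rw [← hij]
    exact hk i (by rintro rfl; exact hj rfl)
  have hdown : ∀ j, succIdx (skel R) l ≠ j → phiW θ (skel R) (l + 1) < phiW θ (skel R) j := by
    intro j hj
    obtain ⟨i, rfl, hij⟩ := exists_succIdx_eq hθ j
    rw [← hij]
    exact hl i (by rintro rfl; exact hj rfl)
  have hk' : phiW θ (skel R) k < phiW θ (skel R) (k + 1) := hup k fun h => hkx (by rw [h])
  have hl' : phiW θ (skel R) (l + 1) < phiW θ (skel R) l := hdown l fun h => hlx (by rw [h])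
  have hlowk : lowerEnd θ (skel R) k + |θ ((skel R).get k).1| = phiW θ (skel R) (k + 1) := by
    rw [← hstep, max_eq_right hk'.le]
  have hlowl : lowerEnd θ (skel R) l = phiW θ (skel R) (l + 1) := min_eq_right hl'.le
  have key : ∀ j : Fin (skel R).length, (
      lowerEnd θ (skel R) j < lowerEnd θ (skel R) k + |θ ((skel R).get k).1|) ∧
      (j ≠ k → ((skel R).get j).1 = ((skel R).get k).1 →
        lowerEnd θ (skel R) j < lowerEnd θ (skel R) k) ∧
      (lowerEnd θ (skel R) l ≤ lowerEnd θ (skel R) j) ∧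
      (j ≠ l → ((skel R).get j).1 = ((skel R).get l).1 →
        lowerEnd θ (skel R) l < lowerEnd θ (skel R) j) := by
    intro j
    have hj := hstep j
    have hjpos := hpos ((skel R).get j).1
    refine ⟨?_, fun hjk hx => ?_, ?_, fun hjl hx => ?_⟩
    · rw [hlowk]
      rcases eq_or_ne j k with rfl | hjk
      · rw [← hlowk]; lia
      · exact (min_le_right _ _).trans_lt (hk j hjk)
    · have h1 := hk j hjk
      have h2 := hup j fun h => hkx (by rw [h, hx])
      have h3 := max_lt h2 h1
      rw [hj, ← hlowk, hx] at h3
      lia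
    · rw [hlowl]
      refine le_min ?_ ?_
      · obtain ⟨i, -, hij⟩ := exists_succIdx_eq hθ j
        rw [← hij]
        rcases eq_or_ne i l with rfl | hil
        · rfl
        · exact (hl i hil).le
      · rcases eq_or_ne j l with rfl | hjl
        · rfl
        · exact (hl j hjl).le
    · rw [hlowl]
      exact lt_min (hdown j fun h => hlx (by rw [h, hx])) (hl j hjl)
  simp only [hget] at key
  refine ⟨k.cast hlen, l.cast hlen, hpos _, fun j => (key (j.cast hlen.symm)).1,
    fun j hj => (key (j.cast hlen.symm)).2.1 ?_, fun j => (key (j.cast hlen.symm)).2.2.1,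
    fun j hj => (key (j.cast hlen.symm)).2.2.2 ?_⟩
  · rintro rfl; exact hj rfl
  · rintro rfl; exact hj rfl

section Labellings

variable {X H Q : Type*}

open scoped Classical in
/-- The labelling of edges determined by a sequence `u`: edges `a` are labelled by `u`, edges `b`
by `u` shifted by `c`, and any other edge by a constant depending only on its letter. -/
noncomputable def seqEdges (a b : X) (c : ℤ) (κ : X → Q) (u : ℤ → Q) (v : ℤ) (x : X) : Q :=
  if x = a then u v else if x = b then u (v - c) else κ x

theorem seqEdges_update_of_ne (a b : X) (c : ℤ) (κ : X → Q) (u : ℤ → Q) (w : ℤ) (q : Q) (v : ℤ)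
    (x : X) (ha : x = a → v ≠ w) (hb : x ≠ a → x = b → v - c ≠ w) :
    seqEdges a b c κ (Function.update u w q) v x = seqEdges a b c κ u v x := by
  unfold seqEdges
  split_ifs with h1 h2
  · rw [Function.update_of_ne (ha h1)]
  · rw [Function.update_of_ne (hb h1 h2)]
  · rfl

theorem seqEdges_add (a b : X) (c : ℤ) (κ : X → Q) (u : ℤ → Q) (d : ℤ) :
    (fun v => seqEdges a b c κ u (v + d)) = seqEdges a b c κ fun j => u (j + d) := by
  funext v x
  simp only [seqEdges, sub_add_eq_add_sub]

theorem map_seqEdges {Q' : Type*} (π : Q → Q') (a b : X) (c : ℤ) (κ : X → Q) (u : ℤ → Q) :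
    (fun v x => π (seqEdges a b c κ u v x)) =
      seqEdges a b c (fun x => π (κ x)) fun j => π (u j) := by
  funext v x
  simp only [seqEdges, apply_ite π]

variable [Group H] [Group Q]

theorem existsUnique_signedPow (P S : Q) (ε : Bool) : ∃! q : Q, P * signedPow ε q * S = 1 := by
  refine ⟨signedPow ε (P⁻¹ * S⁻¹), by simp [signedPow_signedPow], fun q hq => ?_⟩
  apply signedPow_injective ε
  rw [signedPow_signedPow, eq_mul_inv_iff_mul_eq, eq_inv_iff_mul_eq_one]
  exact mul_eq_one_comm.1 ((mul_assoc _ _ _).symm.trans hq)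

variable {θ : X → ℤ} {R : List (X × Bool × H)} {k l : Fin R.length} {c : ℤ}

/-- The relator `R`, imposed at all levels on a labelling `seqEdges u`, is a two-sided recursion
for `u`. -/
theorem IsExtremalPair.isTwoSidedRecursion (h : IsExtremalPair θ R k l)
    (hc : R[k.1].1 = R[l.1].1 → c = 0) (hc' : R[k.1].1 ≠ R[l.1].1 → |θ R[k.1].1| < c)
    (f : Coprod H (FreeGroup X) →* Q) (κ : X → Q) :
    IsTwoSidedRecursion
      (fun i u => pathValue θ f (seqEdges R[k.1].1 R[l.1].1 c κ u) i R = 1)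
      (lowerEnd θ (skel R) l - c) (lowerEnd θ (skel R) k) := by
  have hpos := h.weight_pos
  have hc0 : 0 ≤ c := by
    by_cases hab : R[k.1].1 = R[l.1].1
    · exact (hc hab).ge
    · have := hc' hab; lia
  have hlk := h.le k
  refine ⟨by lia, fun i u v huv hu => ?_, fun i u => ?_, fun i u => ?_⟩
  · rw [← hu]
    refine pathValue_congr θ f R i _ _ fun j hj => ?_
    have h1 := h.lt_top ⟨j, hj⟩
    have h2 := h.le ⟨j, hj⟩
    have h3 := h.lt_of_ne ⟨j, hj⟩
    dsimp only at h1 h2 h3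
    unfold seqEdges
    split_ifs with hja hjb
    · refine (huv _ (by lia) ?_).symm
      by_cases hjk : (⟨j, hj⟩ : Fin R.length) = k
      · rw [← hjk]
      · have := h3 hjk hja
        lia
    · have := hc' fun e => hja (hjb.trans e.symm)
      exact (huv _ (by lia) (by lia)).symm
    · rfl
  · obtain ⟨P, S, hPS⟩ := exists_pathValue_eq θ f R i k k.2 (seqEdges R[k.1].1 R[l.1].1 c κ u)
    convert existsUnique_signedPow P S R[k.1].2.1 using 3 with q
    rw [hPS]
    · simp [seqEdges]
    · intro j hj hjk
      have h1 := h.lt_top ⟨j, hj⟩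
      have h3 := h.lt_of_ne ⟨j, hj⟩ fun e => hjk (by rw [← e])
      dsimp only at h1 h3
      refine seqEdges_update_of_ne _ _ _ _ _ _ _ _ _ (fun e => ?_) fun e e' => ?_
      · have := h3 e; lia
      · have := hc' fun e'' => e (e'.trans e''.symm)
        lia
  · obtain ⟨P, S, hPS⟩ := exists_pathValue_eq θ f R i l l.2 (seqEdges R[k.1].1 R[l.1].1 c κ u)
    convert existsUnique_signedPow P S R[l.1].2.1 using 3 with q
    rw [hPS]
    · by_cases hab : R[k.1].1 = R[l.1].1
      · simp [seqEdges, hab, hc hab]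
      · simp [seqEdges, Ne.symm hab, add_sub_assoc]
    · intro j hj hjl
      have h2 := h.le ⟨j, hj⟩
      have h3 := h.lt_of_ne' ⟨j, hj⟩ fun e => hjl (by rw [← e])
      dsimp only at h2 h3
      refine seqEdges_update_of_ne _ _ _ _ _ _ _ _ _ (fun e => ?_) fun e e' => ?_
      · by_cases hab : R[k.1].1 = R[l.1].1
        · have := h3 (e.trans hab)
          have := hc hab
          lia
        · have := hc' hab; lia
      · have := h3 e'; lia

/-- The labellings `seqEdges u` which satisfy the relator `R` at all levels. -/
def relatorLabellings (θ : X → ℤ) (f : Coprod H (FreeGroup X) →* Q) (R : List (X × Bool × H))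
    (a b : X) (c : ℤ) (κ : X → Q) : Set (ℤ → X → Q) :=
  seqEdges a b c κ '' {u | ∀ i, pathValue θ f (seqEdges a b c κ u) i R = 1}

theorem relatorLabellings_shift (f : Coprod H (FreeGroup X) →* Q) (a b : X) (κ : X → Q) :
    ∀ β ∈ relatorLabellings θ f R a b c κ, ∀ d : ℤ,
      (fun v => β (v + d)) ∈ relatorLabellings θ f R a b c κ := by
  rintro _ ⟨u, hu, rfl⟩ d
  refine ⟨fun j => u (j + d), fun i => ?_, (seqEdges_add a b c κ u d).symm⟩
  rw [← seqEdges_add, ← pathValue_add]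
  exact hu _

theorem pathValue_eq_one_of_mem (f : Coprod H (FreeGroup X) →* Q) (a b : X) (κ : X → Q) :
    ∀ β ∈ relatorLabellings θ f R a b c κ, pathValue θ f β 0 R = 1 := by
  rintro _ ⟨u, hu, rfl⟩
  exact hu 0

end Labellings

/-- The coefficient group of a presentation with the unique max-min property embeds in the group
it defines. -/
theorem natHom_injective {X H : Type*} [Group H] {R : List (X × Bool × H)}
    (hR : HasUniqueMaxMin (skel R)) : Function.Injective (natHom R) := by
  obtain ⟨θ, hθ⟩ := hR
  obtain ⟨k, l, hkl⟩ := hθ.exists_isExtremalPair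
  rw [injective_iff_map_eq_one]
  intro h hh
  classical
  let c : ℤ := if R[k.1].1 = R[l.1].1 then 0 else |θ R[k.1].1| + 1
  let f : Coprod H (FreeGroup X) →* H := Coprod.lift (MonoidHom.id H) 1
  have hrec := hkl.isTwoSidedRecursion (c := c) (fun e => if_pos e)
    (fun e => by simp only [c, if_neg e]; lia) f fun _ => 1
  obtain ⟨u, -, hu⟩ := hrec.exists_solution 0 fun _ => 1
  obtain ⟨Φ, hΦ⟩ := exists_relGroup_hom _ θ f
    (relatorLabellings_shift (θ := θ) (R := R) (c := c) f R[k.1].1 R[l.1].1 fun _ => 1) R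
    hθ.2.2.2.1 (pathValue_eq_one_of_mem f _ _ _)
  have := hΦ h [] _ ⟨u, hu, rfl⟩ (by
    have h1 : Coprod.inl h * relWord ([] : List (X × Bool × H)) = Coprod.inl h := mul_one _
    rw [h1]
    exact (congrArg Φ hh).trans (map_one Φ))
  simpa [pathValue, f] using this

section Separation

variable {X H : Type*} [Group H] {θ : X → ℤ} {R : List (X × Bool × H)} {k l : Fin R.length}

/-- A solution of the relator recursion over `H ∗ F(X)` which takes constant values on an initial
window agrees, modulo the relator, with that constant on a larger window. -/
theorem IsExtremalPair.mk_solution_eq (h : IsExtremalPair θ R k l) {c p q : ℤ}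
    (hc : R[k.1].1 ≠ R[l.1].1 → q - p + |θ R[k.1].1| < c)
    {u : ℤ → Coprod H (FreeGroup X)}
    (hu : ∀ i, pathValue θ (MonoidHom.id _) (seqEdges R[k.1].1 R[l.1].1 c
      (fun x => Coprod.inr (FreeGroup.of x)) u) i R = 1)
    (hua : ∀ j, p ≤ j → j < p - lowerEnd θ (skel R) l + lowerEnd θ (skel R) k →
      u j = Coprod.inr (FreeGroup.of R[k.1].1))
    (hub : R[k.1].1 ≠ R[l.1].1 → ∀ j, p - c ≤ j → j < p →
      u j = Coprod.inr (FreeGroup.of R[l.1].1))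
    (j : ℤ) (hpj : p ≤ j) (hjq : j ≤ q) :
    QuotientGroup.mk' (Subgroup.normalClosure {relWord R}) (u j) =
      QuotientGroup.mk' _ (Coprod.inr (FreeGroup.of R[k.1].1)) := by
  obtain ⟨n, hn⟩ : ∃ n : ℕ, j = p + n := ⟨(j - p).toNat, by lia⟩
  induction n using Nat.strong_induction_on generalizing j with
  | _ n ih =>
  set π := QuotientGroup.mk' (Subgroup.normalClosure {relWord R}) with hπ
  rcases lt_or_ge j (p - lowerEnd θ (skel R) l + lowerEnd θ (skel R) k) with hj | hj
  · rw [hua j hpj hj]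
  have hrel : π (relWord R) = 1 :=
    (QuotientGroup.eq_one_iff _).2 (Subgroup.subset_normalClosure rfl)
  have h1 := congrArg π (hu (j - lowerEnd θ (skel R) k))
  have h2 := pathValue_const θ π R (j - lowerEnd θ (skel R) k)
  rw [map_pathValue, MonoidHom.comp_id, map_one] at h1
  rw [hrel] at h2
  obtain ⟨P, S, hPS⟩ := exists_pathValue_eq θ π R (j - lowerEnd θ (skel R) k) k k.2
    fun _ x => π (Coprod.inr (FreeGroup.of x))
  rw [hPS _ fun _ _ _ => rfl] at h2
  rw [hPS] at h1
  · have := (existsUnique_signedPow P S R[k.1].2.1).unique h1 h2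
    simpa [seqEdges] using this
  · intro j' hj' hjk
    have h3 := h.lt_top ⟨j', hj'⟩
    have h4 := h.le ⟨j', hj'⟩
    have h5 := h.lt_of_ne ⟨j', hj'⟩ fun e => hjk (by rw [← e])
    dsimp only at h3 h4 h5
    unfold seqEdges
    split_ifs with hja hjb
    · have := h5 hja
      rw [hja]
      exact ih (j - lowerEnd θ (skel R) k + lowerEnd θ (skel R) j' - p).toNat (by lia) _
        (by lia) (by lia) (by lia)
    · have hab : R[k.1].1 ≠ R[l.1].1 := fun e => hja (hjb.trans e.symm)
      have := hc hab
      rw [hjb, hub hab _ (by lia) (by lia)]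
    · rfl

/-- Over a residually finite coefficient group, a presentation with the unique max-min property
defines a residually finite group. -/
theorem relGroup_residuallyFinite (hR : HasUniqueMaxMin (skel R)) (hH : ResiduallyFinite H) :
    ResiduallyFinite (relGroup R) := by
  obtain ⟨θ, hθ⟩ := hR
  obtain ⟨k, l, hkl⟩ := hθ.exists_isExtremalPair
  apply ResiduallyFinite.of_forall_exists_hom
  intro g hg
  obtain ⟨w, rfl⟩ := QuotientGroup.mk'_surjective _ g
  obtain ⟨h₀, L, rfl⟩ := exists_eq_inl_mul_relWord w
  obtain ⟨K, hK⟩ : ∃ K : ℤ, ∀ j < L.length, |lowerEnd θ (skel L) j| ≤ K := by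
    obtain ⟨K, hK⟩ := ((Set.finite_lt_nat L.length).image fun j => |lowerEnd θ (skel L) j|).bddAbove
    exact ⟨K, fun j hj => hK ⟨j, hj, rfl⟩⟩
  classical
  set a := R[k.1].1
  set b := R[l.1].1
  let c : ℤ := if a = b then 0 else max 0 (2 * K) + |θ a| + 1
  have hc : a ≠ b → c = max 0 (2 * K) + |θ a| + 1 := fun e => if_neg e
  have hc0 : a = b → c = 0 := fun e => if_pos e
  let κ : X → Coprod H (FreeGroup X) := fun x => Coprod.inr (FreeGroup.of x)
  have hlk := hkl.le k
  obtain ⟨u, hu₀, hu⟩ := (hkl.isTwoSidedRecursion (c := c) hc0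
    (fun e => by have := hc e; lia) (MonoidHom.id _) κ).exists_solution
      (-K - lowerEnd θ (skel R) l) fun j => if -K ≤ j then κ a else κ b
  have hc_nonneg : 0 ≤ c := by
    by_cases hab : a = b
    · exact (hc0 hab).ge
    · have := hc hab
      have := abs_nonneg (θ a)
      lia
  have hub : a ≠ b → ∀ j, -K - c ≤ j → j < -K → u j = κ b := fun _ j h1 h2 => by
    rw [hu₀ j (by lia) (by lia), if_neg (by lia)]
  have hπ := hkl.mk_solution_eq (p := -K) (q := K) (c := c)
    (fun e => by have := hc e; lia) hu
    (fun j h1 h2 => by rw [hu₀ j (by lia) (by lia), if_pos h1]) hub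
  have hgL : QuotientGroup.mk' (Subgroup.normalClosure {relWord R})
      (pathValue θ (MonoidHom.id _) (seqEdges a b c κ u) 0 L) =
        QuotientGroup.mk' _ (relWord L) := by
    rw [map_pathValue, MonoidHom.comp_id, ← pathValue_const θ (QuotientGroup.mk' _) L 0]
    refine pathValue_congr θ _ L 0 _ _ fun j hj => ?_
    have := abs_le.1 (hK j hj)
    rw [zero_add]
    unfold seqEdges
    split_ifs with hja hjb
    · rw [hja]
      exact hπ _ (by lia) (by lia)
    · have hab : a ≠ b := fun e => hja (hjb.trans e.symm)
      have := hc hab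
      have := abs_nonneg (θ a)
      rw [hjb, hub hab _ (by lia) (by lia)]
    · rfl
  obtain ⟨Q, _, _, f, hf⟩ := (hH.coprod (ResiduallyFinite.freeGroup X))
    (Coprod.inl h₀ * pathValue θ (MonoidHom.id _) (seqEdges a b c κ u) 0 L) (by
      intro e
      apply hg
      rw [map_mul, ← hgL, ← map_mul, e]
      exact map_one _)
  have hfval : ∀ i (L : List (X × Bool × H)),
      pathValue θ f (seqEdges a b c (fun x => f (κ x)) fun j => f (u j)) i L =
        f (pathValue θ (MonoidHom.id _) (seqEdges a b c κ u) i L) := by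
    intro i L
    rw [map_pathValue, map_seqEdges, MonoidHom.comp_id]
  let E := relatorLabellings θ f R a b c fun x => f (κ x)
  have hE : Finite E := ((hkl.isTwoSidedRecursion (c := c) hc0
    (fun e => by have := hc e; lia) f fun x => f (κ x)).finite_solutions.image _).to_subtype
  obtain ⟨Φ, hΦ⟩ := exists_relGroup_hom E θ f (relatorLabellings_shift f a b _) R
    hθ.2.2.2.1 (pathValue_eq_one_of_mem f _ _ _)
  refine ⟨Equiv.Perm (Q × E), inferInstance, inferInstance, Φ, fun e => hf ?_⟩
  rw [map_mul, ← hfval]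
  exact hΦ h₀ L _ ⟨_, fun i => by rw [hfval, hu, map_one], rfl⟩ e

end Separation

theorem exists_hom_zmod {G : Type*} [Group G] {n : ℕ} {g : G} (hg : g ^ n = 1) :
    ∃ τ : Multiplicative (ZMod n) →* G, τ (Multiplicative.ofAdd 1) = g := by
  let φ : ℤ →+ Additive G := (zpowersHom G g).toAdditiveRight
  have hφ : φ n = 0 := by
    simp [φ, hg]
  refine ⟨(ZMod.lift n ⟨φ, hφ⟩).toMultiplicativeLeft, ?_⟩
  have := ZMod.lift_coe n ⟨φ, hφ⟩ 1
  rw [Int.cast_one] at this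
  simp [this, φ]

section CyclicExtension

variable {X H : Type*} [Group H]

/-- The relator `R t`, where `R = L x^ε h` and `t` is a generator of a cyclic group of order `n`
adjoined to the coefficient group. -/
def cyclicRelator (L : List (X × Bool × H)) (s : X × Bool × H) (n : ℕ) :
    List (X × Bool × Coprod H (Multiplicative (ZMod n))) :=
  L.map (fun s => (s.1, s.2.1, Coprod.inl s.2.2)) ++
    [(s.1, s.2.1, Coprod.inl s.2.2 * Coprod.inr (Multiplicative.ofAdd 1))]

theorem skel_cyclicRelator (L : List (X × Bool × H)) (s : X × Bool × H) (n : ℕ) :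
    skel (cyclicRelator L s n) = skel (L ++ [s]) := by
  simp [skel, cyclicRelator]

theorem relWord_cyclicRelator (L : List (X × Bool × H)) (s : X × Bool × H) (n : ℕ) :
    relWord (cyclicRelator L s n) =
      Coprod.map Coprod.inl (MonoidHom.id _) (relWord (L ++ [s])) *
        Coprod.inl (Coprod.inr (Multiplicative.ofAdd 1)) := by
  simp only [relWord, cyclicRelator, List.map_append, List.map_map, List.prod_append, map_mul,
    map_list_prod, Function.comp_def]
  simp only [List.map_cons, List.map_nil, List.prod_singleton, map_mul, Coprod.map_apply_inl,
    Coprod.map_apply_inr, MonoidHom.id_apply]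
  exact (congrArg _ (mul_assoc _ _ _).symm).trans (mul_assoc _ _ _).symm

/-- Adjoining to `⟨x, H; Rⁿ⟩` a generator `t` of order `n` equal to `R⁻¹` embeds it in the group of
a presentation with the same skeleton as `R`. -/
theorem exists_relGroupPow_injective_hom (L : List (X × Bool × H)) (s : X × Bool × H) (n : ℕ) :
    ∃ Ψ : relGroupPow (L ++ [s]) n →* relGroup (cyclicRelator L s n), Function.Injective Ψ := by
  let π := QuotientGroup.mk' (Subgroup.normalClosure {relWord (L ++ [s]) ^ n})
  let π' := QuotientGroup.mk' (Subgroup.normalClosure {relWord (cyclicRelator L s n)})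
  let ι : Coprod H (FreeGroup X) →* Coprod (Coprod H (Multiplicative (ZMod n))) (FreeGroup X) :=
    Coprod.map Coprod.inl (MonoidHom.id _)
  have hπ : π (relWord (L ++ [s])) ^ n = 1 := by
    rw [← map_pow]
    exact (QuotientGroup.eq_one_iff _).2 (Subgroup.subset_normalClosure rfl)
  have hπ' : π' (ι (relWord (L ++ [s])) *
      Coprod.inl (Coprod.inr (Multiplicative.ofAdd 1))) = 1 :=
    (congrArg π' (relWord_cyclicRelator L s n)).symm.trans
      ((QuotientGroup.eq_one_iff _).2 (Subgroup.subset_normalClosure rfl))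
  obtain ⟨τ, hτ⟩ := exists_hom_zmod (n := n) (g := (π (relWord (L ++ [s])))⁻¹)
    (by rw [inv_pow, hπ, inv_one])
  let χ := Coprod.lift (Coprod.lift (π.comp Coprod.inl) τ) (π.comp Coprod.inr)
  have hχ : χ.comp ι = π := by
    ext <;> simp [χ, ι]
  have hker : Subgroup.normalClosure {relWord (L ++ [s]) ^ n} ≤ (π'.comp ι).ker := by
    apply Subgroup.normalClosure_le_normal
    rw [Set.singleton_subset_iff, SetLike.mem_coe, MonoidHom.mem_ker, map_pow]
    rw [map_mul, mul_eq_one_iff_eq_inv] at hπ'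
    rw [MonoidHom.comp_apply, hπ', inv_pow, inv_eq_one, ← map_pow, ← map_pow, ← map_pow,
      ← ofAdd_nsmul, nsmul_one, CharP.cast_eq_zero, ofAdd_zero, map_one, map_one, map_one]
  have hker' : Subgroup.normalClosure {relWord (cyclicRelator L s n)} ≤ χ.ker := by
    apply Subgroup.normalClosure_le_normal
    rw [Set.singleton_subset_iff, SetLike.mem_coe, MonoidHom.mem_ker, relWord_cyclicRelator,
      map_mul]
    have h1 : χ (ι (relWord (L ++ [s]))) = π (relWord (L ++ [s])) := DFunLike.congr_fun hχ _
    rw [h1, Coprod.lift_apply_inl, Coprod.lift_apply_inr, hτ, mul_inv_cancel]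
  refine ⟨QuotientGroup.lift _ (π'.comp ι) hker, Function.LeftInverse.injective
    (g := QuotientGroup.lift _ χ hker') fun g => ?_⟩
  obtain ⟨w, rfl⟩ := QuotientGroup.mk'_surjective _ g
  exact DFunLike.congr_fun hχ w

end CyclicExtension

/-- **Theorem 3** (Pride). If `G = ⟨x, H; R⟩` is a residually finite
`M_H`-group, then for every `n > 1` the group `G_n = ⟨x, H; Rⁿ⟩` is also
residually finite. -/
theorem relGroupPow_residuallyFinite {X H : Type*} [Group H]
    (R : List (X × Bool × H)) (hP : HasUniqueMaxMin (skel R))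
    (hG : ResiduallyFinite (relGroup R)) :
    ∀ n : ℕ, 1 < n → ResiduallyFinite (relGroupPow R n) := by
  intro n hn
  have : NeZero n := ⟨by lia⟩
  obtain rfl | ⟨L, s, rfl⟩ := R.eq_nil_or_concat'
  · obtain ⟨θ, hθ⟩ := hP
    exact absurd rfl hθ.1
  have hfin : Finite (Multiplicative (ZMod n)) := inferInstanceAs (Finite (ZMod n))
  obtain ⟨Ψ, hΨ⟩ := exists_relGroupPow_injective_hom L s n
  refine ResiduallyFinite.of_injective (relGroup_residuallyFinite ?_ ?_) Ψ hΨ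
  · rwa [skel_cyclicRelator]
  · exact (hG.of_injective _ (natHom_injective hP)).coprod ResiduallyFinite.of_finite
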